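/- Assume g₀(0)·g₁(0) > 0 and let τ = min{ |g(0)|, max( sign(g(0))·g(g₀⁻¹(0)), sign(g(0))·g(g₁⁻¹(0)) ) }. Then: (i) for every ε ∈ [0,1] with ε ≥ τ there exist ε₀, ε₁ ∈ [0,1] such that DPDisp(f_{ε₀,ε₁}^ens) ≤ ε and err(f_{ε₀,ε₁}^ens) = err(f_ε^CFL); (ii) for every ε ∈ [0,1] with ε < τ and all ε₀, ε₁ ∈ [0,1] such that DPDisp(f_{ε₀,ε₁}^ens) ≤ ε, one has err(f_{ε₀,ε₁}^ens) > err(f_ε^CFL). That is, when the unconstrained optimal classifier favors the same group on both clients, LFT+Ensemble matches centralized fair learning exactly for fairness levels at least τ and is strictly worse below τ. -/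

import Mathlib

open MeasureTheory Set

noncomputable section

/-- A randomized classifier: measurable in `x` for each group, values in `[0,1]`. -/
def IsClf (f : ℝ → Fin 2 → ℝ) : Prop :=
  (∀ a, Measurable fun x => f x a) ∧ ∀ x a, f x a ∈ Icc (0:ℝ) 1

/-- Classification error of a randomized classifier. -/
def errF (q : ℝ) (η : ℝ → ℝ) (P0 P1 : Measure ℝ) (f : ℝ → Fin 2 → ℝ) : ℝ :=
  (1 - q) * (∫ x, (f x 0 * (1 - η x) + (1 - f x 0) * η x) ∂P0)
    + q * ∫ x, (f x 1 * (1 - η x) + (1 - f x 1) * η x) ∂P1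

/-- Mean difference between the two groups. -/
def MDF (P0 P1 : Measure ℝ) (f : ℝ → Fin 2 → ℝ) : ℝ :=
  (∫ x, f x 0 ∂P0) - ∫ x, f x 1 ∂P1

/-- Demographic parity disparity. -/
def DPD (P0 P1 : Measure ℝ) (f : ℝ → Fin 2 → ℝ) : ℝ := |MDF P0 P1 f|

/-- The function `g`. -/
def gFun (q : ℝ) (η : ℝ → ℝ) (P0 P1 : Measure ℝ) (lam : ℝ) : ℝ :=
  (P0 {x | η x > 1/2 - lam / (2*(1-q))}).toReal
    - (P1 {x | η x > 1/2 + lam / (2*q)}).toReal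

/-- The threshold classifier with parameter `λ`. -/
def fThresh (q : ℝ) (η : ℝ → ℝ) (lam : ℝ) : ℝ → Fin 2 → ℝ := fun x a =>
  if a = 0 then (if η x > 1/2 - lam / (2*(1-q)) then 1 else 0)
  else (if η x > 1/2 + lam / (2*q) then 1 else 0)

/-- `g` is a continuous strictly increasing bijection from `[-M,M]` onto `[-1,1]`,
with inverse `ginv`. -/
def GoodG (M : ℝ) (g ginv : ℝ → ℝ) : Prop :=
  ContinuousOn g (Icc (-M) M) ∧ StrictMonoOn g (Icc (-M) M) ∧
    g '' Icc (-M) M = Icc (-1) 1 ∧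
    (∀ lam ∈ Icc (-M) M, ginv (g lam) = lam) ∧
    (∀ y ∈ Icc (-1:ℝ) 1, ginv y ∈ Icc (-M) M ∧ g (ginv y) = y)

lemma GoodG.neg {M : ℝ} {g i : ℝ → ℝ} (h : GoodG M g i) :
    GoodG M (fun u => -g (-u)) (fun y => -i (-y)) := by
  obtain ⟨h1, h2, h3, h4, h5⟩ := h
  have hm : ∀ u ∈ Icc (-M) M, -u ∈ Icc (-M) M := fun u hu =>
    ⟨by linarith [hu.2], by linarith [hu.1]⟩
  have hm1 : ∀ u ∈ Icc (-1:ℝ) 1, -u ∈ Icc (-1:ℝ) 1 := fun u hu =>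
    ⟨by linarith [hu.2], by linarith [hu.1]⟩
  have e5 : ∀ y ∈ Icc (-1:ℝ) 1, -i (-y) ∈ Icc (-M) M ∧ -g (-(-i (-y))) = y := by
    intro y hy
    obtain ⟨a, b⟩ := h5 _ (hm1 y hy)
    refine ⟨hm _ a, ?_⟩
    rw [neg_neg, b, neg_neg]
  refine ⟨?_, ?_, ?_, ?_, e5⟩
  · exact (h1.comp continuous_neg.continuousOn hm).neg
  · intro a ha b hb hab
    have := h2 (hm b hb) (hm a ha) (neg_lt_neg hab)
    simp only
    linarith
  · apply Subset.antisymm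
    · rintro _ ⟨u, hu, rfl⟩
      have : g (-u) ∈ Icc (-1:ℝ) 1 := by
        rw [← h3]; exact ⟨_, hm u hu, rfl⟩
      exact hm1 _ this
    · intro y hy
      exact ⟨_, (e5 y hy).1, (e5 y hy).2⟩
  · intro u hu
    simp only [neg_neg]
    rw [h4 _ (hm u hu), neg_neg]

lemma GoodG.mem {M : ℝ} {g i : ℝ → ℝ} (h : GoodG M g i) {u : ℝ} (hu : u ∈ Icc (-M) M) :
    g u ∈ Icc (-1:ℝ) 1 := by
  rw [← h.2.2.1]; exact ⟨_, hu, rfl⟩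

lemma GoodG.inv_le {M : ℝ} {g i : ℝ → ℝ} (h : GoodG M g i) {y u : ℝ} (hy : y ∈ Icc (-1:ℝ) 1)
    (hu : u ∈ Icc (-M) M) : i y ≤ u ↔ y ≤ g u := by
  rw [← h.2.1.le_iff_le (h.2.2.2.2 y hy).1 hu, (h.2.2.2.2 y hy).2]

lemma GoodG.le_inv {M : ℝ} {g i : ℝ → ℝ} (h : GoodG M g i) {y u : ℝ} (hy : y ∈ Icc (-1:ℝ) 1)
    (hu : u ∈ Icc (-M) M) : u ≤ i y ↔ g u ≤ y := by
  rw [← h.2.1.le_iff_le hu (h.2.2.2.2 y hy).1, (h.2.2.2.2 y hy).2]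

lemma core {M : ℝ} (hM : 0 ≤ M) {g0 g1 gg i0 i1 ig : ℝ → ℝ} (h0 : GoodG M g0 i0)
    (h1 : GoodG M g1 i1) (hg : GoodG M gg ig) (hgg : ∀ u, gg u = (g0 u + g1 u) / 2)
    (p0 : 0 < g0 0) (p1 : 0 < g1 0) (E D : ℝ → ℝ → ℝ) (hD : ∀ u, D u u = gg u)
    (hgap : ∀ l ∈ Icc (-M) M, ∀ a ∈ Icc (-M) M, ∀ b ∈ Icc (-M) M, (a ≠ l ∨ b ≠ l) →
      l * (D a b - D l l) < E a b - E l l) :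
    (∀ ε ∈ Icc (0:ℝ) 1, min (gg 0) (max (gg (i0 0)) (gg (i1 0))) ≤ ε →
      ∃ e0 ∈ Icc (0:ℝ) 1, ∃ e1 ∈ Icc (0:ℝ) 1,
        |D (i0 (min e0 (g0 0))) (i1 (min e1 (g1 0)))| ≤ ε ∧
        E (i0 (min e0 (g0 0))) (i1 (min e1 (g1 0)))
          = E (ig (min ε (gg 0))) (ig (min ε (gg 0)))) ∧
    (∀ ε ∈ Icc (0:ℝ) 1, ε < min (gg 0) (max (gg (i0 0)) (gg (i1 0))) →
      ∀ e0 ∈ Icc (0:ℝ) 1, ∀ e1 ∈ Icc (0:ℝ) 1,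
        |D (i0 (min e0 (g0 0))) (i1 (min e1 (g1 0)))| ≤ ε →
        E (ig (min ε (gg 0))) (ig (min ε (gg 0))) <
          E (i0 (min e0 (g0 0))) (i1 (min e1 (g1 0)))) := by
  have m0 : (0:ℝ) ∈ Icc (-M) M := ⟨by linarith, hM⟩
  have z0 : (0:ℝ) ∈ Icc (-1:ℝ) 1 := ⟨by norm_num, by norm_num⟩
  have pg : 0 < gg 0 := by rw [hgg]; linarith
  have G0 := h0.mem m0
  have G1 := h1.mem m0
  have Gg := hg.mem m0
  obtain ⟨l0m, l0e⟩ := h0.2.2.2.2 0 z0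
  obtain ⟨l1m, l1e⟩ := h1.2.2.2.2 0 z0
  have l0n : i0 0 ≤ 0 := (h0.inv_le z0 m0).2 p0.le
  have l1n : i1 0 ≤ 0 := (h1.inv_le z0 m0).2 p1.le
  have r0 : gg (i0 0) ≤ gg 0 := (hg.2.1.le_iff_le l0m m0).2 l0n
  have r1 : gg (i1 0) ≤ gg 0 := (hg.2.1.le_iff_le l1m m0).2 l1n
  rw [min_eq_right (max_le r0 r1)]
  constructor
  · intro ε hε hτ
    have hy : min ε (gg 0) ∈ Icc (-1:ℝ) 1 :=
      ⟨by linarith [le_min hε.1 pg.le], (min_le_left _ _).trans hε.2⟩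
    obtain ⟨lm, le⟩ := hg.2.2.2.2 _ hy
    set l := ig (min ε (gg 0)) with hl
    have a0 : i0 0 ≤ l := (hg.le_inv hy l0m).2 (le_min ((le_max_left _ _).trans hτ) r0)
    have a1 : i1 0 ≤ l := (hg.le_inv hy l1m).2 (le_min ((le_max_right _ _).trans hτ) r1)
    have ln : l ≤ 0 := (hg.inv_le hy m0).2 (min_le_right _ _)
    have b0 : 0 ≤ g0 l := (h0.inv_le z0 lm).1 a0
    have b1 : 0 ≤ g1 l := (h1.inv_le z0 lm).1 a1
    have c0 : g0 l ≤ g0 0 := (h0.2.1.le_iff_le lm m0).2 ln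
    have c1 : g1 l ≤ g1 0 := (h1.2.1.le_iff_le lm m0).2 ln
    refine ⟨g0 l, ⟨b0, (h0.mem lm).2⟩, g1 l, ⟨b1, (h1.mem lm).2⟩, ?_⟩
    rw [min_eq_left c0, min_eq_left c1, h0.2.2.2.1 l lm, h1.2.2.2.1 l lm]
    refine ⟨?_, rfl⟩
    rw [hD, le, abs_of_nonneg (le_min hε.1 pg.le)]
    exact min_le_left _ _
  · intro ε hε hτ e0 he0 e1 he1 hd
    have hlt : ε ≤ gg 0 := hτ.le.trans (max_le r0 r1)
    rw [min_eq_left hlt]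
    have hy : ε ∈ Icc (-1:ℝ) 1 := ⟨by linarith [hε.1], hε.2⟩
    obtain ⟨lm, le⟩ := hg.2.2.2.2 _ hy
    have ln : ig ε ≤ 0 := (hg.inv_le hy m0).2 hlt
    have y0 : 0 ≤ min e0 (g0 0) := le_min he0.1 p0.le
    have y1 : 0 ≤ min e1 (g1 0) := le_min he1.1 p1.le
    have y0m : min e0 (g0 0) ∈ Icc (-1:ℝ) 1 := ⟨by linarith, (min_le_left _ _).trans he0.2⟩
    have y1m : min e1 (g1 0) ∈ Icc (-1:ℝ) 1 := ⟨by linarith, (min_le_left _ _).trans he1.2⟩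
    have k0 : i0 0 ≤ i0 (min e0 (g0 0)) := (h0.le_inv y0m l0m).2 (by rw [l0e]; exact y0)
    have k1 : i1 0 ≤ i1 (min e1 (g1 0)) := (h1.le_inv y1m l1m).2 (by rw [l1e]; exact y1)
    have hne : i0 (min e0 (g0 0)) ≠ ig ε ∨ i1 (min e1 (g1 0)) ≠ ig ε := by
      rcases lt_max_iff.1 hτ with h | h
      · left
        have : ig ε < i0 0 := lt_of_not_ge fun hh => by
          have := (hg.le_inv hy l0m).1 hh
          linarith
        exact (this.trans_le k0).ne'
      · right
        have : ig ε < i1 0 := lt_of_not_ge fun hh => by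
          have := (hg.le_inv hy l1m).1 hh
          linarith
        exact (this.trans_le k1).ne'
    have := hgap _ lm _ (h0.2.2.2.2 _ y0m).1 _ (h1.2.2.2.2 _ y1m).1 hne
    rw [hD (ig ε), le] at this
    have hd2 := (abs_le.1 hd).2
    nlinarith

lemma set_gap (μ : Measure ℝ) [IsFiniteMeasure μ] (h : ℝ → ℝ) (hi : Integrable h μ)
    (S T : Set ℝ) (hS : MeasurableSet S) (hT : MeasurableSet T)
    (hSd : ∀ x, x ∈ S ↔ h x < 0) (hz : μ {x | h x = 0} = 0) :
    0 ≤ (∫ x in T, h x ∂μ) - ∫ x in S, h x ∂μ ∧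
      (μ.real T ≠ μ.real S → 0 < (∫ x in T, h x ∂μ) - ∫ x in S, h x ∂μ) := by
  rw [← integral_indicator hT, ← integral_indicator hS,
    ← integral_sub (hi.indicator hT) (hi.indicator hS)]
  have hnn : ∀ x, 0 ≤ T.indicator h x - S.indicator h x := by
    intro x
    by_cases a : x ∈ T <;> by_cases b : x ∈ S <;> simp only [indicator, a, b, if_true, if_false]
    · simp
    · rw [hSd] at b; linarith
    · rw [hSd] at b; linarith
    · simp
  have h0 : 0 ≤ ∫ x, (T.indicator h x - S.indicator h x) ∂μ := integral_nonneg fun x => hnn x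
  refine ⟨h0, fun hne => lt_of_le_of_ne h0 fun he => hne ?_⟩
  have hae := (integral_eq_zero_iff_of_nonneg (fun x => hnn x)
    ((hi.indicator hT).sub (hi.indicator hS))).1 he.symm
  apply measureReal_congr
  have hz' : ∀ᵐ x ∂μ, h x ≠ 0 := by
    rw [ae_iff]; simpa using hz
  filter_upwards [hae, hz'] with x hx hx0
  apply propext
  change x ∈ T ↔ x ∈ S
  by_cases a : x ∈ T <;> by_cases b : x ∈ S <;> simp [indicator, a, b] at hx ⊢ <;> exact hx0 hx

lemma fT_zero (q : ℝ) (η : ℝ → ℝ) (l x : ℝ) : fThresh q η l x 0 =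
    ({x | η x > 1/2 - l / (2*(1-q))} : Set ℝ).indicator (fun _ => (1:ℝ)) x := by
  simp [fThresh, indicator]

lemma fT_one (q : ℝ) (η : ℝ → ℝ) (l x : ℝ) : fThresh q η l x 1 =
    ({x | η x > 1/2 + l / (2*q)} : Set ℝ).indicator (fun _ => (1:ℝ)) x := by
  simp [fThresh, indicator]

lemma int_avg (μ : Measure ℝ) [IsFiniteMeasure μ] (A B : Set ℝ) (hA : MeasurableSet A)
    (hB : MeasurableSet B) :
    ∫ x, (A.indicator (fun _ => (1:ℝ)) x + B.indicator (fun _ => (1:ℝ)) x) / 2 ∂μ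
      = (μ.real A + μ.real B) / 2 := by
  rw [integral_div, integral_add ((integrable_const _).indicator hA)
    ((integrable_const _).indicator hB), integral_indicator hA, integral_indicator hB]
  simp

lemma int_err (μ : Measure ℝ) [IsFiniteMeasure μ] (η : ℝ → ℝ) (hi : Integrable η μ)
    (A B : Set ℝ) (hA : MeasurableSet A) (hB : MeasurableSet B) :
    ∫ x, ((A.indicator (fun _ => (1:ℝ)) x + B.indicator (fun _ => (1:ℝ)) x) / 2 * (1 - η x)
      + (1 - (A.indicator (fun _ => (1:ℝ)) x + B.indicator (fun _ => (1:ℝ)) x) / 2) * η x) ∂μ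
      = (∫ x, η x ∂μ) + ((∫ x in A, (1 - 2 * η x) ∂μ) + ∫ x in B, (1 - 2 * η x) ∂μ) / 2 := by
  have hi2 : Integrable (fun x => 1 - 2 * η x) μ := (integrable_const _).sub (hi.const_mul 2)
  rw [← integral_indicator hA, ← integral_indicator hB,
    ← integral_add (hi2.indicator hA) (hi2.indicator hB), ← integral_div,
    ← integral_add hi (g := fun a => (A.indicator (fun x => 1 - 2 * η x) a
      + B.indicator (fun x => 1 - 2 * η x) a) / 2)
      (((hi2.indicator hA).add (hi2.indicator hB)).div_const 2)]
  congr 1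
  ext x
  by_cases a : x ∈ A <;> by_cases b : x ∈ B <;> simp [indicator, a, b] <;> ring

lemma set_lin (μ : Measure ℝ) [IsFiniteMeasure μ] (η : ℝ → ℝ) (hi : Integrable η μ)
    (A : Set ℝ) (c l : ℝ) :
    ∫ x in A, (c * (1 - 2 * η x) + l) ∂μ = c * (∫ x in A, (1 - 2 * η x) ∂μ) + l * μ.real A := by
  have hi2 : Integrable (fun x => 1 - 2 * η x) μ := (integrable_const _).sub (hi.const_mul 2)
  rw [integral_add (hi2.const_mul c).integrableOn (integrable_const _), integral_const_mul]
  simp [mul_comm]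

/-- ensemble of two threshold classifiers -/
def ensT (q : ℝ) (η : ℝ → ℝ) (a b : ℝ) : ℝ → Fin 2 → ℝ :=
  fun x s => (fThresh q η a x s + fThresh q η b x s) / 2

lemma ensT_self (q : ℝ) (η : ℝ → ℝ) (a : ℝ) : ensT q η a a = fThresh q η a := by
  ext x s; simp [ensT]

section
variable (q : ℝ) (η : ℝ → ℝ) (μ ν : Measure ℝ) [IsFiniteMeasure μ] [IsFiniteMeasure ν]

lemma MD_ens (hη : Measurable η) (a b : ℝ) :
    MDF μ ν (ensT q η a b) = (gFun q η μ ν a + gFun q η μ ν b) / 2 := by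
  have hm : ∀ c, MeasurableSet {x | η x > c} := fun c => measurableSet_lt measurable_const hη
  simp only [MDF, ensT, fT_zero, fT_one, gFun]
  rw [int_avg _ _ _ (hm _) (hm _), int_avg _ _ _ (hm _) (hm _)]
  simp only [Measure.real]
  ring

lemma gap (hq : q ∈ Ioo (0:ℝ) 1) (hη : Measurable η) (hi : Integrable η μ) (hj : Integrable η ν)
    (hn : ∀ c, μ {x | η x = c} = 0) (hn' : ∀ c, ν {x | η x = c} = 0) (l a b : ℝ)
    (hne : gFun q η μ ν a ≠ gFun q η μ ν l ∨ gFun q η μ ν b ≠ gFun q η μ ν l) :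
    l * (MDF μ ν (ensT q η a b) - MDF μ ν (ensT q η l l)) <
      errF q η μ ν (ensT q η a b) - errF q η μ ν (ensT q η l l) := by
  have hm : ∀ c, MeasurableSet {x | η x > c} := fun c => measurableSet_lt measurable_const hη
  have q0 := hq.1
  have q1 : 0 < 1 - q := by linarith [hq.2]
  rw [MD_ens q η μ ν hη, MD_ens q η μ ν hη]
  simp only [errF, ensT, fT_zero, fT_one]
  rw [int_err μ η hi _ _ (hm _) (hm _), int_err ν η hj _ _ (hm _) (hm _),
    int_err μ η hi _ _ (hm _) (hm _), int_err ν η hj _ _ (hm _) (hm _)]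
  have key0 : ∀ t, _ := fun t => set_gap μ (fun x => (1 - q) * (1 - 2 * η x) + -l)
    (((((integrable_const (1:ℝ)).sub (hi.const_mul 2)).const_mul (1-q))).add (integrable_const _))
    {x | η x > 1/2 - l / (2*(1-q))} {x | η x > 1/2 - t / (2*(1-q))} (hm _) (hm _)
    (fun x => by
      simp only [mem_ofPred_eq, gt_iff_lt]
      rw [sub_lt_comm, lt_div_iff₀ (by positivity)]
      constructor <;> intro h <;> nlinarith)
    (by
      convert hn (1/2 - l / (2*(1-q))) using 3
      ext x
      have e : η x = 1/2 - l / (2*(1-q)) ↔ l = (1/2 - η x) * (2*(1-q)) := by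
        rw [← div_eq_iff (by positivity)]
        constructor <;> intro h <;> linarith
      rw [e]
      constructor <;> intro h <;> linarith)
  have key1 : ∀ t, _ := fun t => set_gap ν (fun x => q * (1 - 2 * η x) + l)
    (((((integrable_const (1:ℝ)).sub (hj.const_mul 2)).const_mul q)).add (integrable_const _))
    {x | η x > 1/2 + l / (2*q)} {x | η x > 1/2 + t / (2*q)} (hm _) (hm _)
    (fun x => by
      simp only [mem_ofPred_eq, gt_iff_lt]
      rw [← lt_sub_iff_add_lt', div_lt_iff₀ (by positivity)]
      constructor <;> intro h <;> nlinarith)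
    (by
      convert hn' (1/2 + l / (2*q)) using 3
      ext x
      rw [← sub_eq_iff_eq_add', eq_div_iff (by positivity)]
      constructor <;> intro h <;> linarith)
  simp only [set_lin μ η hi, set_lin ν η hj] at key0 key1
  have hs : ∀ t, gFun q η μ ν t ≠ gFun q η μ ν l →
      μ.real {x | η x > 1/2 - t / (2*(1-q))} ≠ μ.real {x | η x > 1/2 - l / (2*(1-q))} ∨
      ν.real {x | η x > 1/2 + t / (2*q)} ≠ ν.real {x | η x > 1/2 + l / (2*q)} := by
    intro t ht
    by_contra! hc
    apply ht
    simp only [gFun]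
    simp only [Measure.real] at hc
    rw [hc.1, hc.2]
  obtain ⟨a0, a0'⟩ := key0 a
  obtain ⟨b0, b0'⟩ := key0 b
  obtain ⟨a1, a1'⟩ := key1 a
  obtain ⟨b1, b1'⟩ := key1 b
  have hgr : ∀ t, gFun q η μ ν t = μ.real {x | η x > 1/2 - t / (2*(1-q))}
    - ν.real {x | η x > 1/2 + t / (2*q)} := fun t => rfl
  rcases hne with h | h
  · rcases hs _ h with h | h
    · have := a0' h
      simp only [hgr]; linarith
    · have := a1' h
      simp only [hgr]; linarith
  · rcases hs _ h with h | h
    · have := b0' h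
      simp only [hgr]; linarith
    · have := b1' h
      simp only [hgr]; linarith
end

lemma gFun_mix (q : ℝ) (η : ℝ → ℝ) (μ ν : Fin 2 → Measure ℝ) [∀ i, IsProbabilityMeasure (μ i)]
    [∀ i, IsProbabilityMeasure (ν i)] (l : ℝ) :
    gFun q η ((2:ENNReal)⁻¹ • (μ 0 + μ 1)) ((2:ENNReal)⁻¹ • (ν 0 + ν 1)) l
      = (gFun q η (μ 0) (ν 0) l + gFun q η (μ 1) (ν 1) l) / 2 := by
  simp only [gFun, Measure.smul_apply, Measure.add_apply, smul_eq_mul, ENNReal.toReal_mul,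
    ENNReal.toReal_inv, ENNReal.toReal_ofNat]
  rw [ENNReal.toReal_add (by finiteness) (by finiteness),
    ENNReal.toReal_add (by finiteness) (by finiteness)]
  ring

/-- if the ERM favors the same group on both clients
(`g₀(0)·g₁(0) > 0`), then with
`τ = min(|g(0)|, max(sign(g(0))·g(g₀⁻¹(0)), sign(g(0))·g(g₁⁻¹(0))))`,
LFT+Ensemble matches the centralized optimum for every fairness level `ε ≥ τ` and
is strictly worse for every `ε < τ`. -/
theorem ensemble_vs_cfl_same_bias
    (q : ℝ) (hq : q ∈ Ioo (0:ℝ) 1)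
    (P0 P1 : Fin 2 → Measure ℝ)
    [∀ i, IsProbabilityMeasure (P0 i)] [∀ i, IsProbabilityMeasure (P1 i)]
    (hposint : ∀ i, ∀ x y : ℝ, x < y → 0 < (P0 i) (Ioo x y) ∧ 0 < (P1 i) (Ioo x y))
    (η : ℝ → ℝ) (hη_mono : StrictMono η) (hη_mem : ∀ x, η x ∈ Icc (0:ℝ) 1)
    (hnull : ∀ i, ∀ c : ℝ, (P0 i) {x | η x = c} = 0 ∧ (P1 i) {x | η x = c} = 0)
    (g : Fin 2 → ℝ → ℝ) (hgdef : ∀ i, g i = gFun q η (P0 i) (P1 i))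
    (ginv : Fin 2 → ℝ → ℝ)
    (hg : ∀ i, GoodG (max q (1 - q)) (g i) (ginv i))
    (gg : ℝ → ℝ) (hggdef : ∀ lam, gg lam = (g 0 lam + g 1 lam) / 2)
    (ginvg : ℝ → ℝ) (hgg : GoodG (max q (1 - q)) gg ginvg)
    (hsame : 0 < g 0 0 * g 1 0)
    (τ : ℝ)
    (hτ : τ = min |gg 0|
      (max (Real.sign (gg 0) * gg (ginv 0 0)) (Real.sign (gg 0) * gg (ginv 1 0))))
    (fens : ℝ → ℝ → (ℝ → Fin 2 → ℝ))
    (hfens : ∀ e0 e1, fens e0 e1 = fun x a =>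
      (fThresh q η (ginv 0 (Real.sign (g 0 0) * min e0 |g 0 0|)) x a
        + fThresh q η (ginv 1 (Real.sign (g 1 0) * min e1 |g 1 0|)) x a) / 2)
    (fcfl : ℝ → (ℝ → Fin 2 → ℝ))
    (hfcfl : ∀ e, fcfl e = fThresh q η (ginvg (Real.sign (gg 0) * min e |gg 0|))) :
    (∀ ε ∈ Icc (0:ℝ) 1, τ ≤ ε →
      ∃ e0 ∈ Icc (0:ℝ) 1, ∃ e1 ∈ Icc (0:ℝ) 1,
        DPD ((2:ENNReal)⁻¹ • (P0 0 + P0 1)) ((2:ENNReal)⁻¹ • (P1 0 + P1 1)) (fens e0 e1) ≤ ε ∧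
        errF q η ((2:ENNReal)⁻¹ • (P0 0 + P0 1)) ((2:ENNReal)⁻¹ • (P1 0 + P1 1)) (fens e0 e1)
          = errF q η ((2:ENNReal)⁻¹ • (P0 0 + P0 1)) ((2:ENNReal)⁻¹ • (P1 0 + P1 1)) (fcfl ε)) ∧
    (∀ ε ∈ Icc (0:ℝ) 1, ε < τ →
      ∀ e0 ∈ Icc (0:ℝ) 1, ∀ e1 ∈ Icc (0:ℝ) 1,
        DPD ((2:ENNReal)⁻¹ • (P0 0 + P0 1)) ((2:ENNReal)⁻¹ • (P1 0 + P1 1)) (fens e0 e1) ≤ ε →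
        errF q η ((2:ENNReal)⁻¹ • (P0 0 + P0 1)) ((2:ENNReal)⁻¹ • (P1 0 + P1 1)) (fcfl ε)
          < errF q η ((2:ENNReal)⁻¹ • (P0 0 + P0 1)) ((2:ENNReal)⁻¹ • (P1 0 + P1 1))
              (fens e0 e1)) := by
  have hηm : Measurable η := hη_mono.monotone.measurable
  have fin0 : IsFiniteMeasure ((2:ENNReal)⁻¹ • (P0 0 + P0 1)) :=
    (P0 0 + P0 1).smul_finite (by simp)
  have fin1 : IsFiniteMeasure ((2:ENNReal)⁻¹ • (P1 0 + P1 1)) :=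
    (P1 0 + P1 1).smul_finite (by simp)
  have hggm : ∀ l, gFun q η ((2:ENNReal)⁻¹ • (P0 0 + P0 1)) ((2:ENNReal)⁻¹ • (P1 0 + P1 1)) l
      = gg l := by
    intro l
    rw [gFun_mix, hggdef, hgdef, hgdef]
  have hn0 : ∀ c, ((2:ENNReal)⁻¹ • (P0 0 + P0 1)) {x | η x = c} = 0 := fun c => by
    simp [(hnull 0 c).1, (hnull 1 c).1]
  have hn1 : ∀ c, ((2:ENNReal)⁻¹ • (P1 0 + P1 1)) {x | η x = c} = 0 := fun c => by
    simp [(hnull 0 c).2, (hnull 1 c).2]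
  generalize ((2:ENNReal)⁻¹ • (P0 0 + P0 1)) = μ at *
  generalize ((2:ENNReal)⁻¹ • (P1 0 + P1 1)) = ν at *
  have hint : ∀ (κ : Measure ℝ) [IsFiniteMeasure κ], Integrable η κ := fun κ _ =>
    Integrable.of_bound hηm.aestronglyMeasurable 1 (Filter.Eventually.of_forall fun x => by
      rw [Real.norm_eq_abs, abs_of_nonneg (hη_mem x).1]; exact (hη_mem x).2)
  have hM : 0 ≤ max q (1 - q) := hq.1.le.trans (le_max_left _ _)
  have hfens' : ∀ e0 e1, fens e0 e1 = ensT q η (ginv 0 (Real.sign (g 0 0) * min e0 |g 0 0|))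
      (ginv 1 (Real.sign (g 1 0) * min e1 |g 1 0|)) := hfens
  have hfcfl' : ∀ e, fcfl e = ensT q η (ginvg (Real.sign (gg 0) * min e |gg 0|))
      (ginvg (Real.sign (gg 0) * min e |gg 0|)) := fun e => by rw [ensT_self, hfcfl]
  have hgap : ∀ l ∈ Icc (-max q (1 - q)) (max q (1 - q)),
      ∀ a ∈ Icc (-max q (1 - q)) (max q (1 - q)), ∀ b ∈ Icc (-max q (1 - q)) (max q (1 - q)),
      (a ≠ l ∨ b ≠ l) → l * (MDF μ ν (ensT q η a b) - MDF μ ν (ensT q η l l)) <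
      errF q η μ ν (ensT q η a b) - errF q η μ ν (ensT q η l l) := by
    intro l hl a ha b hb h
    apply gap q η μ ν hq hηm (hint μ) (hint ν) hn0 hn1
    simp only [hggm]
    exact h.imp (fun h h' => h (hgg.2.1.injOn ha hl h')) (fun h h' => h (hgg.2.1.injOn hb hl h'))
  have hD : ∀ u, MDF μ ν (ensT q η u u) = gg u := fun u => by
    rw [MD_ens q η μ ν hηm, hggm]; ring
  simp only [hfens', hfcfl', DPD, hτ]
  rcases pos_and_pos_or_neg_and_neg_of_mul_pos hsame with ⟨p0, p1⟩ | ⟨p0, p1⟩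
  · have pg : 0 < gg 0 := by rw [hggdef]; linarith
    simp only [Real.sign_of_pos p0, Real.sign_of_pos p1, Real.sign_of_pos pg, abs_of_pos p0,
      abs_of_pos p1, abs_of_pos pg, one_mul]
    exact core hM (hg 0) (hg 1) hgg hggdef p0 p1 (fun a b => errF q η μ ν (ensT q η a b))
      (fun a b => MDF μ ν (ensT q η a b)) hD hgap
  · have pg : gg 0 < 0 := by rw [hggdef]; linarith
    simp only [Real.sign_of_neg p0, Real.sign_of_neg p1, Real.sign_of_neg pg, abs_of_neg p0,
      abs_of_neg p1, abs_of_neg pg, neg_mul, one_mul]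
    have := core hM (hg 0).neg (hg 1).neg hgg.neg
      (fun u => by simp only [hggdef]; ring) (by simpa using p0) (by simpa using p1)
      (fun a b => errF q η μ ν (ensT q η (-a) (-b)))
      (fun a b => -MDF μ ν (ensT q η (-a) (-b))) (fun u => by simp only [hD])
      (fun l hl a ha b hb h => by
        have hm : ∀ u ∈ Icc (-max q (1 - q)) (max q (1 - q)),
            -u ∈ Icc (-max q (1 - q)) (max q (1 - q)) := fun u hu =>
          ⟨by linarith [hu.2], by linarith [hu.1]⟩
        have := hgap _ (hm l hl) _ (hm a ha) _ (hm b hb)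
          (h.imp (fun h h' => h (neg_injective h')) (fun h h' => h (neg_injective h')))
        linarith)
    simpa only [neg_neg, neg_zero, abs_neg] using this

end
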